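/- arXiv:2511.23363 — 2 statements merged into one kernel-verified Lean document; each statement's English description precedes it below -/
import Mathlib

section
/- Let p be a prime, let n, r ≥ 1, let k ≥ 1, let ε ∈ (0,1), and let f : 𝔽_p^n → 𝔽_p^r be a function that is ε-far from every additive group homomorphism (equivalently, every 𝔽_p-linear map) from 𝔽_p^n to 𝔽_p^r. Then the fraction of tuples (σ,x) ∈ ({1,…,p−1} × 𝔽_p^n)^{2k} for which Σ_{i=1}^{2k} σ_i f(x_i) ≠ f(Σ_{i=1}^{2k} σ_i x_i) is at least min{ (2k−3)·ε/3 , 1/16 }. -/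
open Classical in
/-- Probability of an event under the uniform distribution on a finite type. -/
noncomputable def uniformProb {α : Type*} [Fintype α] (P : α → Prop) : ℝ :=
  (∑ x, if P x then (1 : ℝ) else 0) / Fintype.card α

namespace uniformProb

variable {α β : Type*} [Fintype α] [Fintype β]

lemma eq_card_div (P : α → Prop) :
    uniformProb P = (Nat.card {x // P x} : ℝ) / (Nat.card α : ℝ) := by
  classical
  simp [uniformProb, Fintype.card_subtype]

lemma mono {P Q : α → Prop} (h : ∀ x, P x → Q x) : uniformProb P ≤ uniformProb Q := by
  unfold uniformProb
  gcongr with x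
  by_cases hP : P x
  · simp [hP, h x hP]
  · simp only [hP, if_false]
    split_ifs <;> norm_num

lemma nonneg (P : α → Prop) : 0 ≤ uniformProb P := by
  unfold uniformProb
  positivity

lemma or_le (P Q : α → Prop) :
    uniformProb (fun x => P x ∨ Q x) ≤ uniformProb P + uniformProb Q := by
  unfold uniformProb
  rw [← add_div, ← Finset.sum_add_distrib]
  gcongr with x
  by_cases hP : P x <;> by_cases hQ : Q x <;> simp [hP, hQ]

lemma true_eq [Nonempty α] : uniformProb (fun _ : α => True) = 1 := by
  simp [uniformProb]

lemma not_eq [Nonempty α] (P : α → Prop) : uniformProb (fun x => ¬ P x) = 1 - uniformProb P := by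
  rw [eq_sub_iff_add_eq, ← true_eq (α := α)]
  unfold uniformProb
  rw [← add_div, ← Finset.sum_add_distrib]
  congr 1
  refine Finset.sum_congr rfl fun x _ => ?_
  by_cases hP : P x <;> simp [hP]

lemma exists_not_of_lt_one [Nonempty α] {P : α → Prop} (h : uniformProb P < 1) : ∃ x, ¬ P x := by
  by_contra! hP
  have := mono (P := fun _ => True) fun x _ => hP x
  rw [true_eq] at this
  linarith

lemma comp_equiv (e : α ≃ β) (P : β → Prop) :
    uniformProb (fun x => P (e x)) = uniformProb P := by
  unfold uniformProb
  rw [Fintype.card_congr e]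
  congr 1
  exact e.sum_comp (fun y => open Classical in if P y then (1 : ℝ) else 0)

lemma prod_eq (P : α × β → Prop) :
    uniformProb P = (∑ a, uniformProb fun b => P (a, b)) / Fintype.card α := by
  unfold uniformProb
  rw [Fintype.sum_prod_type, ← Finset.sum_div, div_div, Fintype.card_prod]
  push_cast
  rw [mul_comm]

lemma swap (P : α × β → Prop) :
    uniformProb (fun x : β × α => P (x.2, x.1)) = uniformProb P :=
  comp_equiv (Equiv.prodComm β α) P

lemma prod_le [Nonempty α] {P : α × β → Prop} {c : ℝ}
    (h : ∀ a, (uniformProb fun b => P (a, b)) ≤ c) : uniformProb P ≤ c := by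
  rw [prod_eq, div_le_iff₀ (by exact_mod_cast Fintype.card_pos)]
  calc _ ≤ ∑ _a : α, c := Finset.sum_le_sum fun a _ => h a
    _ = _ := by simp [mul_comm]

lemma exists_fiber_le [Nonempty α] (P : α × β → Prop) :
    ∃ a, (uniformProb fun b => P (a, b)) ≤ uniformProb P := by
  by_contra! h
  have hlt : ∑ _a : α, uniformProb P < ∑ a, uniformProb fun b => P (a, b) :=
    Finset.sum_lt_sum_of_nonempty Finset.univ_nonempty fun a _ => h a
  rw [Finset.sum_const, Finset.card_univ, nsmul_eq_mul, mul_comm,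
    ← lt_div_iff₀ (by exact_mod_cast Fintype.card_pos), ← prod_eq] at hlt
  exact lt_irrefl _ hlt

lemma fst_eq [Nonempty β] (P : α → Prop) :
    uniformProb (fun x : α × β => P x.1) = uniformProb P := by
  rw [prod_eq]
  conv_rhs => unfold uniformProb
  congr 1
  refine Finset.sum_congr rfl fun a _ => ?_
  by_cases ha : P a
  · simp [ha, true_eq]
  · simp [ha, uniformProb]

lemma snd_eq [Nonempty α] (P : β → Prop) :
    uniformProb (fun x : α × β => P x.2) = uniformProb P := by
  rw [← swap]
  exact fst_eq P

/-- Lower bound for an event on a product by conditioning on an event of the first factor. -/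
lemma le_prod_of_cases [Nonempty α] {P : α × β → Prop} (A : α → Prop) {u v : ℝ}
    (hu : ∀ a, A a → u ≤ uniformProb fun b => P (a, b))
    (hv : ∀ a, ¬ A a → v ≤ uniformProb fun b => P (a, b)) :
    uniformProb A * u + (1 - uniformProb A) * v ≤ uniformProb P := by
  rw [← not_eq, prod_eq]
  unfold uniformProb
  rw [div_mul_eq_mul_div, div_mul_eq_mul_div, ← add_div, Finset.sum_mul, Finset.sum_mul,
    ← Finset.sum_add_distrib]
  gcongr with a
  by_cases ha : A a
  · rw [if_pos ha, if_neg (not_not.mpr ha), one_mul, zero_mul, add_zero]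
    exact hu a ha
  · rw [if_neg ha, if_pos ha, one_mul, zero_mul, zero_add]
    exact hv a ha

lemma cons_eq {m : ℕ} (P : (Fin (m + 1) → α) → Prop) :
    uniformProb (fun z : α × (Fin m → α) => P (Fin.cons z.1 z.2)) = uniformProb P :=
  comp_equiv (Fin.consEquiv fun _ : Fin (m + 1) => α) P

end uniformProb

open uniformProb

section PartialSums

variable {Ω W : Type*} [Fintype Ω] [Nonempty Ω] [AddCommGroup W]

lemma uniformProb_sum_ne_step (e : Ω → W) (b : W) (m : ℕ)
    (h : uniformProb (fun x => e x ≠ 0) ≤ 1 / 2)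
    {q : ℝ} (hq : q ≤ uniformProb fun t : Fin m → Ω => ∑ i, e (t i) ≠ b) :
    q * (1 - 2 * uniformProb fun x => e x ≠ 0) + (uniformProb fun x => e x ≠ 0) ≤
      uniformProb fun t : Fin (m + 1) → Ω => ∑ i, e (t i) ≠ b := by
  set η := uniformProb fun x => e x ≠ 0 with hη
  rw [← cons_eq, ← swap]
  have key := le_prod_of_cases
    (P := fun x : (Fin m → Ω) × Ω => ∑ i, e ((Fin.cons x.2 x.1 : Fin (m + 1) → Ω) i) ≠ b)
    (fun t : Fin m → Ω => ∑ i, e (t i) ≠ b) (u := 1 - η) (v := η) ?_ ?_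
  · refine le_trans ?_ key
    nlinarith
  · intro t ht
    rw [hη, ← not_eq]
    refine mono fun x hx => ?_
    simpa [Fin.sum_univ_succ, not_not.mp hx] using ht
  · intro t ht
    refine mono fun x hx => ?_
    simpa [Fin.sum_univ_succ, not_not.mp ht] using hx

lemma le_uniformProb_sum_ne_zero (e : Ω → W) (h : uniformProb (fun x => e x ≠ 0) ≤ 1 / 2) (m : ℕ) :
    (1 - (1 - 2 * uniformProb fun x => e x ≠ 0) ^ m) / 2 ≤
      uniformProb fun t : Fin m → Ω => ∑ i, e (t i) ≠ 0 := by
  induction m with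
  | zero => simpa using nonneg _
  | succ m ih =>
    refine le_trans (le_of_eq ?_) (uniformProb_sum_ne_step e 0 m h ih)
    ring

lemma half_le_uniformProb_sum_ne (e : Ω → W) (h : uniformProb (fun x => e x ≠ 0) ≤ 1 / 2)
    {b : W} (hb : b ≠ 0) (m : ℕ) :
    1 / 2 ≤ uniformProb fun t : Fin m → Ω => ∑ i, e (t i) ≠ b := by
  induction m with
  | zero => simp [hb.symm, true_eq]; norm_num
  | succ m ih =>
    refine le_trans (le_of_eq ?_) (uniformProb_sum_ne_step e b m h ih)
    ring

end PartialSums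

/-- A function nearly satisfying Pexider's equation is close to an affine map. -/
lemma exists_affine_of_pexider {V W : Type*} [AddCommGroup V] [Fintype V] [AddCommGroup W]
    (f φ ψ : V → W) {δ : ℝ} (hδ : 6 * δ < 1)
    (h : uniformProb (fun x : V × V => f (x.1 + x.2) ≠ φ x.1 + ψ x.2) ≤ δ) :
    ∃ (g : V →+ W) (b : W), uniformProb (fun x => f x ≠ g x + b) ≤ 2 * δ := by
  have hdiff : ∀ d, ∃ w, uniformProb (fun z => f (z + d) - f z ≠ w) ≤ 2 * δ := by
    intro d
    let shear : V × V ≃ V × V :=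
      { toFun := fun x => (x.1, x.1 + x.2)
        invFun := fun x => (x.1, x.2 - x.1)
        left_inv := fun x => by simp
        right_inv := fun x => by simp }
    have hshift := comp_equiv (Equiv.prodCongr (Equiv.addRight d) (Equiv.refl V))
      (fun x : V × V => f (x.1 + x.2) ≠ φ x.1 + ψ x.2)
    have hall : uniformProb (fun x : V × V => f (x.2 + d) - f x.2 ≠ φ (x.1 + d) - φ x.1)
        ≤ 2 * δ := by
      rw [← comp_equiv shear]
      refine le_trans (mono fun x hx => ?_) ((or_le _ _).trans
        (le_trans (add_le_add (hshift.le.trans h) h) (by linarith)))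
      by_contra! hc
      obtain ⟨h₁, h₂⟩ := hc
      refine hx ?_
      simp only [Equiv.prodCongr_apply, Prod.map, Equiv.coe_addRight, Equiv.refl_apply] at h₁
      have h₃ : x.1 + x.2 + d = x.1 + d + x.2 := by abel
      simp only [shear, Equiv.coe_fn_mk, h₃, h₁, h₂]
      abel
    obtain ⟨a, ha⟩ := exists_fiber_le
      (fun x : V × V => f (x.2 + d) - f x.2 ≠ φ (x.1 + d) - φ x.1)
    exact ⟨φ (a + d) - φ a, ha.trans hall⟩
  choose g hg using hdiff
  have hadd : ∀ d d', g (d + d') = g d + g d' := by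
    intro d d'
    have h₁ := (comp_equiv (Equiv.addRight d) (fun z => f (z + d') - f z ≠ g d')).le.trans (hg d')
    obtain ⟨z, hz⟩ := exists_not_of_lt_one (lt_of_le_of_lt ((or_le _ _).trans
      (add_le_add (hg (d + d')) ((or_le _ _).trans (add_le_add (hg d) h₁)))) (by linarith))
    push Not at hz
    obtain ⟨h₂, h₃, h₄⟩ := hz
    simp only [Equiv.coe_addRight] at h₄
    rw [← h₂, ← h₃, ← h₄, add_assoc]
    abel
  let G : V →+ W := AddMonoidHom.mk' g hadd
  have hpair : uniformProb (fun x : V × V => f (x.1 + x.2) - f x.2 ≠ g x.1) ≤ 2 * δ :=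
    prod_le (P := fun x : V × V => f (x.1 + x.2) - f x.2 ≠ g x.1) fun d => by
      simpa only [add_comm d] using hg d
  let shear : V × V ≃ V × V :=
    { toFun := fun x => (x.2 - x.1, x.1)
      invFun := fun x => (x.2, x.1 + x.2)
      left_inv := fun x => by simp
      right_inv := fun x => by simp }
  rw [← comp_equiv shear] at hpair
  obtain ⟨z, hz⟩ := exists_fiber_le
    (fun x : V × V => f ((shear x).1 + (shear x).2) - f (shear x).2 ≠ g (shear x).1)
  refine ⟨G, f z - G z, le_trans (mono fun x hx => ?_) (hz.trans hpair)⟩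
  intro hc
  refine hx ?_
  simp only [shear, Equiv.coe_fn_mk, sub_add_cancel] at hc
  have hG : g (x - z) = G x - G z := map_sub G x z
  rw [hG, sub_eq_iff_eq_add] at hc
  rw [hc]
  abel

section LinearityTest

variable {F V W : Type*} [Field F] [Fintype F] [AddCommGroup V] [Module F V] [Fintype V]
  [AddCommGroup W] [Module F W]

instance : Nonempty {c : F // c ≠ 0} := ⟨⟨1, one_ne_zero⟩⟩

noncomputable instance : Fintype {c : F // c ≠ 0} := Fintype.ofFinite _

/-- The rejection probability of the linearity test with `K` terms and random coefficients. -/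
noncomputable def rejectProb (F : Type*) {V W : Type*} [Field F] [Fintype F] [AddCommGroup V]
    [Module F V] [Fintype V] [AddCommGroup W] [Module F W] (K : ℕ) (f : V → W) : ℝ :=
  uniformProb fun t : Fin K → {c : F // c ≠ 0} × V =>
    ∑ i, ((t i).1 : F) • f (t i).2 ≠ f (∑ i, ((t i).1 : F) • (t i).2)

/-- The affine bijection `x ↦ σ • x + c`. -/
noncomputable def affineEquiv (σ : {c : F // c ≠ 0}) (c : V) : V ≃ V :=
  (LinearEquiv.smulOfNeZero F V σ.1 σ.2).toEquiv.trans (Equiv.addRight c)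

lemma affineEquiv_apply (σ : {c : F // c ≠ 0}) (c x : V) :
    affineEquiv σ c x = (σ : F) • x + c := rfl

lemma uniformProb_sum_smul (m : ℕ) (P : V → Prop) :
    (uniformProb fun t : Fin (m + 1) → {c : F // c ≠ 0} × V =>
      P (∑ i, ((t i).1 : F) • (t i).2)) ≤ uniformProb P := by
  rw [← cons_eq, ← swap]
  refine prod_le fun t => prod_le fun σ => ?_
  refine le_trans (mono fun x hx => ?_)
    (comp_equiv (affineEquiv σ (∑ i, ((t i).1 : F) • (t i).2)) P).le
  simpa [Fin.sum_univ_succ, affineEquiv_apply] using hx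

lemma rejectProb_sub_linearMap (K : ℕ) (f : V → W) (g : V →ₗ[F] W) :
    rejectProb F K (fun x => f x - g x) = rejectProb F K f := by
  unfold rejectProb
  congr 1
  ext t
  simp [smul_sub, Finset.sum_sub_distrib]

lemma exists_pexider (m : ℕ) (f : V → W) :
    ∃ φ ψ : V → W, uniformProb (fun x : V × V => f (x.1 + x.2) ≠ φ x.1 + ψ x.2) ≤
      rejectProb F (m + 2) f := by
  let Ω := {c : F // c ≠ 0} × V
  let P : (Fin (m + 2) → Ω) → Prop := fun t =>
    ∑ i, ((t i).1 : F) • f (t i).2 ≠ f (∑ i, ((t i).1 : F) • (t i).2)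
  let reorder : (((Fin m → Ω) × {c : F // c ≠ 0} × {c : F // c ≠ 0}) × V × V) ≃
      Ω × Ω × (Fin m → Ω) :=
    { toFun := fun z => ((z.1.2.1, z.2.1), (z.1.2.2, z.2.2), z.1.1)
      invFun := fun z => ((z.2.2, z.1.1, z.2.1.1), z.1.2, z.2.1.2)
      left_inv := fun _ => rfl
      right_inv := fun _ => rfl }
  let e := reorder.trans ((Equiv.prodCongr (Equiv.refl Ω)
    (Fin.consEquiv fun _ : Fin (m + 1) => Ω)).trans (Fin.consEquiv fun _ : Fin (m + 2) => Ω))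
  obtain ⟨⟨t, σ, τ⟩, h⟩ := exists_fiber_le fun z => P (e z)
  rw [comp_equiv e] at h
  set c := ∑ i, ((t i).1 : F) • (t i).2 with hc
  set C := ∑ i, ((t i).1 : F) • f (t i).2 with hC
  let ξ := affineEquiv σ (0 : V)
  let ζ := affineEquiv τ c
  refine ⟨fun x => (σ : F) • f (ξ.symm x), fun y => (τ : F) • f (ζ.symm y) + C,
    le_trans (le_of_eq ?_) h⟩
  rw [← comp_equiv (Equiv.prodCongr ξ ζ)]
  congr 1
  ext ⟨x, y⟩
  simp only [Equiv.prodCongr_apply, Prod.map, Equiv.symm_apply_apply]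
  simp only [ξ, ζ, affineEquiv_apply, add_zero, P, e, reorder, Equiv.trans_apply, Equiv.coe_fn_mk,
    Equiv.refl_apply, Fin.consEquiv_apply, Fin.sum_univ_succ, Fin.cons_zero, Fin.cons_succ,
    ← hc, ← hC, Equiv.prodCongr_apply, Prod.map]
  exact ne_comm

/-- A random nonzero multiple of a nonzero vector hits a given value with probability at most one
half, if there are at least two nonzero scalars. -/
lemma uniformProb_smul_eq_le (hF : 3 ≤ Fintype.card F) {b : W} (hb : b ≠ 0) (w : W) :
    (uniformProb fun σ : {c : F // c ≠ 0} => (σ : F) • b = w) ≤ 1 / 2 := by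
  have hsub : Subsingleton {σ : {c : F // c ≠ 0} // (σ : F) • b = w} :=
    ⟨fun x y => Subtype.ext (Subtype.ext (smul_left_injective F hb (x.2.trans y.2.symm)))⟩
  have hcard : 2 ≤ Nat.card {c : F // c ≠ 0} := by
    rw [← Nat.card_congr unitsEquivNeZero, Nat.card_units, Nat.card_eq_fintype_card]
    omega
  rw [eq_card_div, div_le_iff₀ (by positivity)]
  have h₁ : (Nat.card {σ : {c : F // c ≠ 0} // (σ : F) • b = w} : ℝ) ≤ 1 := by
    exact_mod_cast Finite.card_le_one_iff_subsingleton.mpr hsub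
  have h₂ : (2 : ℝ) ≤ Nat.card {c : F // c ≠ 0} := by exact_mod_cast hcard
  linarith

lemma half_sub_le_rejectProb_of_three_le (hF : 3 ≤ Fintype.card F) (m : ℕ) (h : V → W) {b : W}
    (hb : b ≠ 0) :
    1 / 2 - 2 * uniformProb (fun x => h x ≠ b) ≤ rejectProb F (m + 1) h := by
  let Ω := {c : F // c ≠ 0} × V
  have h₁ := uniformProb_sum_smul (F := F) m (fun x : V => h x ≠ b)
  have h₂ : (uniformProb fun t : Fin (m + 1) → Ω => h (t 0).2 ≠ b) =
      uniformProb (fun x => h x ≠ b) := by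
    rw [← cons_eq]
    simp only [Fin.cons_zero]
    rw [fst_eq (fun x : Ω => h x.2 ≠ b), snd_eq (fun x => h x ≠ b)]
  have h₃ : (uniformProb fun t : Fin (m + 1) → Ω =>
      ∑ i, ((t i).1 : F) • h (t i).2 = b ∧ h (t 0).2 = b) ≤ 1 / 2 := by
    rw [← cons_eq, ← swap]
    refine prod_le fun t => ?_
    rw [← swap]
    refine prod_le fun x => le_trans (mono fun σ hσ => ?_) (uniformProb_smul_eq_le hF hb
      (b - ∑ i, ((t i).1 : F) • h (t i).2))
    simp only [Fin.sum_univ_succ, Fin.cons_zero, Fin.cons_succ] at hσ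
    rw [hσ.2] at hσ
    exact eq_sub_of_add_eq hσ.1
  have h₄ := not_eq (fun t : Fin (m + 1) → Ω =>
    ∑ i, ((t i).1 : F) • h (t i).2 ≠ h (∑ i, ((t i).1 : F) • (t i).2))
  have h₅ : (uniformProb fun t : Fin (m + 1) → Ω =>
      ¬ ∑ i, ((t i).1 : F) • h (t i).2 ≠ h (∑ i, ((t i).1 : F) • (t i).2)) ≤ _ :=
    (mono fun t ht => ?_).trans ((or_le _ _).trans
      (add_le_add h₁ ((or_le _ _).trans (add_le_add h₂.le h₃))))
  · unfold rejectProb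
    linarith
  · by_contra! hc
    obtain ⟨h₆, h₇, h₈⟩ := hc
    exact h₈ ((not_not.mp ht).trans h₆) h₇

lemma half_sub_le_rejectProb_of_card_eq_two (hF : Fintype.card F = 2) (m : ℕ) (hm : Even (m + 1))
    (h : V → W) {b : W} (hb : b ≠ 0) (hη : uniformProb (fun x => h x ≠ b) ≤ 1 / 2) :
    1 / 2 - uniformProb (fun x => h x ≠ b) ≤ rejectProb F (m + 1) h := by
  let Ω := {c : F // c ≠ 0} × V
  have h₁ := uniformProb_sum_smul (F := F) m (fun x : V => h x ≠ b)
  have hone : ∀ σ : {c : F // c ≠ 0}, (σ : F) = 1 := by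
    classical
    intro σ
    by_contra hσ
    have := Finset.card_le_univ ({0, 1, (σ : F)} : Finset F)
    rw [Finset.card_eq_three.mpr ⟨0, 1, (σ : F), zero_ne_one, σ.2.symm, Ne.symm hσ, rfl⟩] at this
    omega
  have hchar : ∀ w : W, (m + 1) • w = 0 := by
    intro w
    have h₂ : ((2 : ℕ) : F) = 0 := by rw [← hF]; exact FiniteField.cast_card_eq_zero F
    obtain ⟨j, hj⟩ := hm
    rw [hj, ← two_mul, ← Nat.cast_smul_eq_nsmul F, Nat.cast_mul, h₂, zero_mul, zero_smul]
  have he : (uniformProb fun x : Ω => h x.2 - b ≠ 0) = uniformProb (fun x => h x ≠ b) := by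
    simp only [ne_eq, sub_eq_zero]
    exact snd_eq fun x => ¬ h x = b
  have h₂ := half_le_uniformProb_sum_ne (fun x : Ω => h x.2 - b) (he.le.trans hη) hb (m + 1)
  have h₃ : (uniformProb fun t : Fin (m + 1) → Ω => ∑ i, (h (t i).2 - b) ≠ b) ≤ _ :=
    (mono fun t ht => ?_).trans ((or_le _ _).trans
      (add_le_add h₁ (le_refl (rejectProb F (m + 1) h))))
  · linarith
  · by_contra! hc
    obtain ⟨h₄, h₅⟩ := hc
    refine ht ?_
    rw [h₄] at h₅
    simpa [hone, Finset.sum_sub_distrib, hchar] using h₅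

lemma sub_le_rejectProb (m : ℕ) (h : V → W) (hη : uniformProb (fun x => h x ≠ 0) ≤ 1 / 2) :
    (1 - (1 - 2 * uniformProb fun x => h x ≠ 0) ^ (m + 1)) / 2 - uniformProb (fun x => h x ≠ 0) ≤
      rejectProb F (m + 1) h := by
  let Ω := {c : F // c ≠ 0} × V
  have h₁ := uniformProb_sum_smul (F := F) m (fun x : V => h x ≠ 0)
  have he : (uniformProb fun x : Ω => (x.1 : F) • h x.2 ≠ 0) = uniformProb (fun x => h x ≠ 0) := by
    rw [← snd_eq (α := {c : F // c ≠ 0}) (fun x => h x ≠ 0)]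
    congr 1
    funext x
    simp [x.1.2]
  have h₂ := le_uniformProb_sum_ne_zero (fun x : Ω => (x.1 : F) • h x.2) (he.le.trans hη) (m + 1)
  rw [he] at h₂
  have h₃ : (uniformProb fun t : Fin (m + 1) → Ω => ∑ i, ((t i).1 : F) • h (t i).2 ≠ 0) ≤ _ :=
    (mono fun t ht => ?_).trans ((or_le _ _).trans
      (add_le_add h₁ (le_refl (rejectProb F (m + 1) h))))
  · linarith
  · by_contra! hc
    obtain ⟨h₄, h₅⟩ := hc
    exact ht (h₅.trans h₄)

end LinearityTest

/-- If the test rejects with probability below `1 / 16`, then the function is close to linear. -/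
lemma exists_close_of_rejectProb_lt {p : ℕ} [Fact p.Prime] {V W : Type*} [AddCommGroup V]
    [Module (ZMod p) V] [Fintype V] [AddCommGroup W] [Module (ZMod p) W] (m : ℕ)
    (hm : Even (m + 2)) (f : V → W) (hf : rejectProb (ZMod p) (m + 2) f < 1 / 16) :
    ∃ g : V →+ W, uniformProb (fun x => f x ≠ g x) ≤ 1 / 8 := by
  obtain ⟨φ, ψ, hφ⟩ := exists_pexider (F := ZMod p) m f
  obtain ⟨g, b, hg⟩ := exists_affine_of_pexider f φ ψ (by linarith) hφ
  obtain rfl | hb := eq_or_ne b 0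
  · exact ⟨g, by simpa using hg.trans (by linarith)⟩
  have hclose : uniformProb (fun x => f x - g x ≠ b) ≤ 1 / 8 := by
    simp only [ne_eq, sub_eq_iff_eq_add']
    exact hg.trans (by linarith)
  have hrej := rejectProb_sub_linearMap (m + 2) f (g.toZModLinearMap p)
  simp only [AddMonoidHom.coe_toZModLinearMap] at hrej
  have hcard : Fintype.card (ZMod p) = p := ZMod.card p
  obtain hp | hp := (Fact.out : p.Prime).two_le.eq_or_lt
  · have := half_sub_le_rejectProb_of_card_eq_two (hcard.trans hp.symm) (m + 1) hm
      (fun x => f x - g x) hb (by linarith)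
    linarith
  · have := half_sub_le_rejectProb_of_three_le (hcard.symm ▸ hp) (m + 1) (fun x => f x - g x) hb
    linarith

lemma min_le_of_close {K : ℕ} (hK : 3 ≤ K) {ε η : ℝ} (hε : 0 < ε) (hεη : ε < η) (hη : η ≤ 1 / 8) :
    min (((K : ℝ) - 3) * ε / 3) (1 / 16) ≤ (1 - (1 - 2 * η) ^ K) / 2 - η := by
  have hK' : (3 : ℝ) ≤ K := by exact_mod_cast hK
  set u := (K : ℝ) * η with hu
  have hu0 : 0 < u := mul_pos (by linarith) (hε.trans hεη)
  have hpow : (1 - 2 * η) ^ K ≤ 1 / (1 + 2 * u) := by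
    have hexp : (1 - 2 * η) ^ K ≤ Real.exp (-(2 * u)) := by
      have h₁ := pow_le_pow_left₀ (by linarith) (Real.one_sub_le_exp_neg (2 * η)) K
      rw [← Real.exp_nat_mul] at h₁
      refine h₁.trans (le_of_eq ?_)
      congr 1
      rw [hu]
      ring
    refine hexp.trans ?_
    rw [Real.exp_neg, ← one_div]
    gcongr
    linarith [Real.add_one_le_exp (2 * u)]
  have hfrac : (1 - 1 / (1 + 2 * u)) / 2 = u / (1 + 2 * u) := by
    field_simp
    ring
  rcases le_total u 1 with h | h
  · refine (min_le_left _ _).trans ?_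
    have h₁ : u / 3 ≤ u / (1 + 2 * u) := by gcongr; linarith
    nlinarith
  · refine (min_le_right _ _).trans ?_
    have h₁ : 1 / 3 ≤ u / (1 + 2 * u) := by
      rw [div_le_div_iff₀ (by norm_num) (by linarith)]
      linarith
    linarith


/-- Relative Hamming distance between two functions on a finite domain. -/
noncomputable def hdist {G H : Type*} [Fintype G] (f g : G → H) : ℝ :=
  (Nat.card {x : G // f x ≠ g x} : ℝ) / (Fintype.card G : ℝ)

theorem stmt18 (p n r : ℕ) [Fact p.Prime] (hn : 1 ≤ n) (hr : 1 ≤ r)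
    (k : ℕ) (hk : 1 ≤ k) (ε : ℝ) (hε0 : 0 < ε) (hε1 : ε < 1)
    (f : (Fin n → ZMod p) → (Fin r → ZMod p))
    (hfar : ∀ h : (Fin n → ZMod p) →+ (Fin r → ZMod p), ε < hdist f ⇑h) :
    min ((2 * (k : ℝ) - 3) * ε / 3) (1 / 16) ≤
      (Nat.card {t : Fin (2 * k) → {c : ZMod p // c ≠ 0} × (Fin n → ZMod p) //
          ∑ i, ((t i).1 : ZMod p) • f ((t i).2) ≠
            f (∑ i, ((t i).1 : ZMod p) • (t i).2)} : ℝ) /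
        (Nat.card (Fin (2 * k) → {c : ZMod p // c ≠ 0} × (Fin n → ZMod p)) : ℝ) := by
  have hdist_eq : ∀ h : (Fin n → ZMod p) →+ (Fin r → ZMod p),
      hdist f ⇑h = uniformProb fun x => f x ≠ h x := by
    intro h
    rw [eq_card_div, hdist, Nat.card_eq_fintype_card (α := Fin n → ZMod p)]
  have hrej := eq_card_div (fun t : Fin (2 * k) → {c : ZMod p // c ≠ 0} × (Fin n → ZMod p) =>
    ∑ i, ((t i).1 : ZMod p) • f ((t i).2) ≠ f (∑ i, ((t i).1 : ZMod p) • (t i).2))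
  rw [← hrej]
  change _ ≤ rejectProb (ZMod p) (2 * k) f
  obtain rfl | hk2 := hk.eq_or_lt
  · refine (min_le_left _ _).trans (le_trans ?_ (nonneg _))
    norm_num
    linarith
  by_contra! hlt
  obtain ⟨m, hm⟩ : ∃ m, 2 * k = m + 2 := ⟨2 * k - 2, by omega⟩
  have hcast : 2 * (k : ℝ) = ((m + 2 : ℕ) : ℝ) := by rw [← hm]; push_cast; rfl
  rw [hcast, hm] at hlt
  obtain ⟨g, hg⟩ := exists_close_of_rejectProb_lt m (hm ▸ even_two_mul k) f
    (hlt.trans_le (min_le_right _ _))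
  have hε : ε < uniformProb fun x => f x ≠ g x := hdist_eq g ▸ hfar g
  have hne : (uniformProb fun x => f x - g x ≠ 0) = uniformProb fun x => f x ≠ g x := by
    simp only [ne_eq, sub_eq_zero]
  have hlow := sub_le_rejectProb (F := ZMod p) (m + 1) (fun x => f x - g x)
    (hne.le.trans (hg.trans (by norm_num)))
  have hsub := rejectProb_sub_linearMap (m + 2) f (g.toZModLinearMap p)
  simp only [AddMonoidHom.coe_toZModLinearMap] at hsub
  rw [hne, hsub] at hlow
  exact absurd (hlt.trans_le ((min_le_of_close (by omega) hε0 hε hg).trans hlow)) (lt_irrefl _)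
end

section
/- Let p be a prime and n ≥ 2. The fraction of all functions f : 𝔽_p^n → 𝔽_p for which there exists an additive group homomorphism h : 𝔽_p^n → 𝔽_p (equivalently, an 𝔽_p-linear map) with dist(f,h) ≤ (p−1)/(2p) is at most p^n · exp( −(p−1)^2 · p^{n−2} / 2 ). -/
open Finset in
/-- **Hoeffding's lemma** for the uniform distribution on a finite type. -/
theorem sum_exp_mul_le_of_mem_Icc {α : Type*} [Fintype α] [Nonempty α] (X : α → ℝ)
    (hX : ∀ a, X a ∈ Set.Icc (0 : ℝ) 1) (t : ℝ) :
    ∑ a, Real.exp (t * X a) ≤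
      Fintype.card α * Real.exp (t * ((∑ a, X a) / Fintype.card α) + t ^ 2 / 8) := by
  let _ : MeasurableSpace α := ⊤
  have hc : (0 : ℝ) < Fintype.card α := by exact_mod_cast Fintype.card_pos
  have integral_eq (f : α → ℝ) : ∫ a, f a ∂(PMF.uniformOfFintype α).toMeasure =
      (∑ a, f a) / Fintype.card α := by
    rw [PMF.integral_eq_sum]
    simp [PMF.uniformOfFintype_apply, div_eq_inv_mul, mul_sum]
  have h := (ProbabilityTheory.hasSubgaussianMGF_of_mem_Icc
    (μ := (PMF.uniformOfFintype α).toMeasure) (X := X) (a := 0) (b := 1)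
    (Measurable.of_discrete.aemeasurable) (Filter.Eventually.of_forall hX)).mgf_le t
  rw [ProbabilityTheory.mgf, integral_eq, integral_eq, div_le_iff₀ hc] at h
  set m := (∑ a, X a) / Fintype.card α
  have hexp : ∑ a, Real.exp (t * X a) = Real.exp (t * m) * ∑ a, Real.exp (t * (X a - m)) := by
    rw [mul_sum]
    refine sum_congr rfl fun a _ => ?_
    rw [← Real.exp_add]
    ring_nf
  rw [hexp, Real.exp_add]
  have h' : ∑ a, Real.exp (t * (X a - m)) ≤ Real.exp (t ^ 2 / 8) * Fintype.card α := by
    refine h.trans_eq ?_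
    congr 2
    push_cast
    norm_num
    ring
  calc _ ≤ Real.exp (t * m) * (Real.exp (t ^ 2 / 8) * Fintype.card α) := by gcongr
    _ = _ := by ring

/-- Chernoff bound for the number of functions close to a given one in Hamming distance. -/
theorem card_hdist_le_le {G H : Type*} [Fintype G] [Nonempty G] [Fintype H] [Nonempty H]
    (g : G → H) (q : ℝ) (hq : q = ((Fintype.card H : ℝ) - 1) / Fintype.card H) :
    (Nat.card {f : G → H // hdist f g ≤ q / 2} : ℝ) ≤
      (Nat.card (G → H) : ℝ) * Real.exp (-(q ^ 2 * Fintype.card G) / 2) := by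
  classical
  have hG : (0 : ℝ) < Fintype.card G := by exact_mod_cast Fintype.card_pos
  have hH : (1 : ℝ) ≤ Fintype.card H := by exact_mod_cast Fintype.card_pos
  have hq0 : 0 ≤ q := by rw [hq]; exact div_nonneg (by linarith) (by linarith)
  set N := (Fintype.card G : ℝ)
  have hdist_eq (f : G → H) :
      hdist f g = (∑ x, if f x ≠ g x then (1 : ℝ) else 0) / N := by
    rw [Finset.sum_boole]
    simp [hdist, N, Fintype.card_subtype]
  have hoeffding (c : H) : ∑ y, Real.exp (-(2 * q) * if y ≠ c then (1 : ℝ) else 0) ≤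
      Fintype.card H * Real.exp (-(3 / 2) * q ^ 2) := by
    refine (sum_exp_mul_le_of_mem_Icc (fun y => if y ≠ c then (1 : ℝ) else 0)
      (fun y => by split_ifs <;> simp) (-(2 * q))).trans_eq ?_
    have hs : (∑ y, if y ≠ c then (1 : ℝ) else 0) = (Fintype.card H : ℝ) - 1 := by
      rw [Finset.sum_boole]
      simp [Finset.filter_ne', Nat.cast_sub (Fintype.card_pos (α := H))]
    rw [hs, ← hq]
    ring_nf
  calc (Nat.card {f : G → H // hdist f g ≤ q / 2} : ℝ)
      = ∑ f : G → H, if hdist f g ≤ q / 2 then (1 : ℝ) else 0 := by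
        simp [Fintype.card_subtype]
    _ ≤ ∑ f : G → H, Real.exp (q ^ 2 * N) *
          ∏ x, Real.exp (-(2 * q) * if f x ≠ g x then (1 : ℝ) else 0) := by
        refine Finset.sum_le_sum fun f _ => ?_
        rw [← Real.exp_sum, ← Real.exp_add, ← Finset.mul_sum]
        split_ifs with hf
        · rw [hdist_eq, div_le_iff₀ hG] at hf
          refine Real.one_le_exp ?_
          nlinarith [mul_le_mul_of_nonneg_left hf hq0]
        · positivity
    _ = Real.exp (q ^ 2 * N) *
          ∏ x, ∑ y, Real.exp (-(2 * q) * if y ≠ g x then (1 : ℝ) else 0) := by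
        rw [← Finset.mul_sum, Finset.prod_univ_sum, Fintype.piFinset_univ]
    _ ≤ Real.exp (q ^ 2 * N) *
          ∏ _x : G, (Fintype.card H * Real.exp (-(3 / 2) * q ^ 2)) := by
        gcongr with x
        exact hoeffding (g x)
    _ = (Nat.card (G → H) : ℝ) * Real.exp (-(q ^ 2 * N) / 2) := by
        rw [Finset.prod_const, Finset.card_univ, mul_pow, ← Real.exp_nat_mul, mul_left_comm,
          ← Real.exp_add]
        simp only [Nat.card_eq_fintype_card, Fintype.card_fun, Nat.cast_pow]
        congr 2
        simp only [N]
        ring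

/-- There are at most `p ^ n` additive homomorphisms from `𝔽_p^n` to `𝔽_p`. -/
theorem card_addMonoidHom_zmod (p n : ℕ) [Fact p.Prime] :
    Nat.card ((Fin n → ZMod p) →+ ZMod p) = p ^ n := by
  rw [Nat.card_congr (AddMonoidHom.toZModLinearMapEquiv p).toEquiv]
  rw [← Nat.card_congr ((Pi.basisFun (ZMod p) (Fin n)).constr (ZMod p)).toEquiv]
  simp

theorem stmt19 (p n : ℕ) [Fact p.Prime] (hn : 2 ≤ n) :
    (Nat.card {f : (Fin n → ZMod p) → ZMod p //
        ∃ h : (Fin n → ZMod p) →+ ZMod p, hdist f ⇑h ≤ ((p : ℝ) - 1) / (2 * p)} : ℝ) /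
      (Nat.card ((Fin n → ZMod p) → ZMod p) : ℝ) ≤
    (p : ℝ) ^ n * Real.exp (-(((p : ℝ) - 1) ^ 2 * (p : ℝ) ^ (n - 2)) / 2) := by
  classical
  have hp : (0 : ℝ) < p := by exact_mod_cast (Fact.out : p.Prime).pos
  set F := (Fin n → ZMod p) → ZMod p
  have : Finite ((Fin n → ZMod p) →+ ZMod p) := DFunLike.finite _
  have := Fintype.ofFinite ((Fin n → ZMod p) →+ ZMod p)
  have hF : (0 : ℝ) < Nat.card F := by exact_mod_cast Nat.card_pos
  have close_le (h : (Fin n → ZMod p) →+ ZMod p) :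
      (Nat.card {f : F // hdist f ⇑h ≤ ((p : ℝ) - 1) / (2 * p)} : ℝ) ≤
        Nat.card F * Real.exp (-(((p : ℝ) - 1) ^ 2 * (p : ℝ) ^ (n - 2)) / 2) := by
    have key := card_hdist_le_le (⇑h) (((p : ℝ) - 1) / p) (by rw [ZMod.card])
    have hpow : (p : ℝ) ^ n = p ^ (n - 2) * p ^ 2 := by rw [← pow_add, Nat.sub_add_cancel hn]
    have hexp : (((p : ℝ) - 1) / p) ^ 2 * (Fintype.card (Fin n → ZMod p) : ℝ) =
        ((p : ℝ) - 1) ^ 2 * (p : ℝ) ^ (n - 2) := by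
      simp only [Fintype.card_fun, ZMod.card, Fintype.card_fin, Nat.cast_pow, hpow]
      field_simp
    rwa [hexp, div_div, mul_comm (p : ℝ) 2] at key
  have union_le : Nat.card {f : F // ∃ h : (Fin n → ZMod p) →+ ZMod p,
        hdist f ⇑h ≤ ((p : ℝ) - 1) / (2 * p)} ≤
      ∑ h : (Fin n → ZMod p) →+ ZMod p,
        Nat.card {f : F // hdist f ⇑h ≤ ((p : ℝ) - 1) / (2 * p)} := by
    simp only [Nat.card_eq_fintype_card, Fintype.card_subtype]
    refine (Finset.card_le_card fun f hf => ?_).trans Finset.card_biUnion_le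
    simpa using hf
  rw [div_le_iff₀ hF]
  calc _ ≤ ∑ h : (Fin n → ZMod p) →+ ZMod p,
        (Nat.card {f : F // hdist f ⇑h ≤ ((p : ℝ) - 1) / (2 * p)} : ℝ) := by
        exact_mod_cast union_le
    _ ≤ ∑ _h : (Fin n → ZMod p) →+ ZMod p,
        Nat.card F * Real.exp (-(((p : ℝ) - 1) ^ 2 * (p : ℝ) ^ (n - 2)) / 2) :=
        Finset.sum_le_sum fun h _ => close_le h
    _ = _ := by
        rw [Finset.sum_const, Finset.card_univ, ← Nat.card_eq_fintype_card,
          card_addMonoidHom_zmod, nsmul_eq_mul]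
        push_cast
        ring
end
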